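/- Kröger-type upper bound: let p ∈ (1,∞), let m be a positive integer, let Ω ⊂ ℝ^N be an open bounded convex domain with diameter D_Ω, and let φ : Ω → (0,∞) be (1/m)-concave. Then μ_p(Ω,φ) ≤ K_kroger(p, N+m)/D_Ω^p, where K_kroger(p,k) := (p+1)·2^{(k+3p)/2}·k^{k+p}. -/

import Mathlib

open MeasureTheory Set Filter Topology

/-- `π_p := 2π (p-1)^{1/p} / (p sin(π/p))`. -/
noncomputable def piP (p : ℝ) : ℝ :=
  2 * Real.pi * (p - 1) ^ (1 / p) / (p * Real.sin (Real.pi / p))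

/-- The first nontrivial Neumann `p`-Laplacian eigenvalue of `Ω` with weight `φ`. -/
noncomputable def muP (p : ℝ) {N : ℕ} (Ω : Set (EuclideanSpace ℝ (Fin N)))
    (φ : EuclideanSpace ℝ (Fin N) → ℝ) : ℝ :=
  sInf { r : ℝ | ∃ (u : EuclideanSpace ℝ (Fin N) → ℝ) (K : NNReal),
    LipschitzWith K u ∧
    ¬ (∀ᵐ x ∂(volume.restrict Ω), u x = 0) ∧
    (∫ x in Ω, φ x * |u x| ^ (p - 2) * u x) = 0 ∧
    r = (∫ x in Ω, φ x * ‖fderiv ℝ u x‖ ^ p) / (∫ x in Ω, φ x * |u x| ^ p) }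

/-- A positive function is `α`-concave on `Ω` if its `α`-th power is concave. -/
def IsAlphaConcaveOn {N : ℕ} (α : ℝ) (Ω : Set (EuclideanSpace ℝ (Fin N)))
    (φ : EuclideanSpace ℝ (Fin N) → ℝ) : Prop :=
  (∀ x ∈ Ω, 0 < φ x) ∧ ConcaveOn ℝ Ω fun x => φ x ^ α


/-- The Kröger-type constant `K_kroger(p,k) := (p+1) 2^{(k+3p)/2} k^{k+p}`. -/
noncomputable def Kkroger (p : ℝ) (k : ℕ) : ℝ :=
  (p + 1) * 2 ^ (((k : ℝ) + 3 * p) / 2) * (k : ℝ) ^ ((k : ℝ) + p)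

section ConeTest

variable {N : ℕ}

/-- The cone function of height `r` centred at `c`, supported in the closed ball of radius `r`. -/
noncomputable def coneFn (c : EuclideanSpace ℝ (Fin N)) (r : ℝ)
    (x : EuclideanSpace ℝ (Fin N)) : ℝ :=
  max (r - dist x c) 0

theorem coneFn_nonneg (c : EuclideanSpace ℝ (Fin N)) (r : ℝ) (x : EuclideanSpace ℝ (Fin N)) :
    0 ≤ coneFn c r x := le_max_right _ _

theorem coneFn_le (c : EuclideanSpace ℝ (Fin N)) {r : ℝ} (hr : 0 ≤ r)
    (x : EuclideanSpace ℝ (Fin N)) : coneFn c r x ≤ r :=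
  max_le (by linarith [dist_nonneg (x := x) (y := c)]) hr

theorem coneFn_eq_zero {c : EuclideanSpace ℝ (Fin N)} {r : ℝ} {x : EuclideanSpace ℝ (Fin N)}
    (h : x ∉ Metric.closedBall c r) : coneFn c r x = 0 := by
  rw [Metric.mem_closedBall, not_le] at h
  exact max_eq_right (by linarith)

theorem coneFn_pos {c : EuclideanSpace ℝ (Fin N)} {r : ℝ} {x : EuclideanSpace ℝ (Fin N)}
    (h : x ∈ Metric.ball c r) : 0 < coneFn c r x :=
  lt_max_of_lt_left (by linarith [Metric.mem_ball.1 h])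

theorem lipschitzWith_coneFn (c : EuclideanSpace ℝ (Fin N)) (r : ℝ) :
    LipschitzWith 1 (coneFn c r) := by
  refine LipschitzWith.max_const (LipschitzWith.of_le_add fun x y => ?_) 0
  linarith [dist_triangle_left y c x]

theorem rpow_one_div_pow {m : ℕ} (hm : 0 < m) {t : ℝ} (ht : 0 ≤ t) :
    (t ^ (1 / m : ℝ)) ^ m = t := by
  rw [one_div, Real.rpow_inv_natCast_pow ht hm.ne']

/-- An `α`-concave function with `α = 1 / m` loses at most a factor `2 ^ m` at a midpoint. -/
theorem IsAlphaConcaveOn.half_pow_mul_le_midpoint {m : ℕ} (hm : 0 < m)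
    {Ω : Set (EuclideanSpace ℝ (Fin N))} {φ : EuclideanSpace ℝ (Fin N) → ℝ}
    (hφ : IsAlphaConcaveOn (1 / m) Ω φ) {c x : EuclideanSpace ℝ (Fin N)}
    (hc : c ∈ Ω) (hx : x ∈ Ω) :
    (1 / 2) ^ m * φ x ≤ φ ((1 / 2 : ℝ) • c + (1 / 2 : ℝ) • x) := by
  have hmem := hφ.2.1 hc hx (by norm_num : (0 : ℝ) ≤ 1 / 2) (by norm_num : (0 : ℝ) ≤ 1 / 2)
    (by norm_num)
  have hcx := hφ.2.2 hc hx (by norm_num : (0 : ℝ) ≤ 1 / 2) (by norm_num : (0 : ℝ) ≤ 1 / 2)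
    (by norm_num)
  simp only [smul_eq_mul] at hcx
  have h1 := Real.rpow_nonneg (hφ.1 c hc).le (1 / m : ℝ)
  have h2 := Real.rpow_nonneg (hφ.1 x hx).le (1 / m : ℝ)
  rw [← rpow_one_div_pow hm (hφ.1 x hx).le, ← rpow_one_div_pow hm (hφ.1 _ hmem).le, ← mul_pow]
  exact pow_le_pow_left₀ (by positivity) (by linarith) m

/-- On a bounded open convex set an `α`-concave function with `α = 1 / m` is bounded above. -/
theorem IsAlphaConcaveOn.exists_le {m : ℕ} (hm : 0 < m)
    {Ω : Set (EuclideanSpace ℝ (Fin N))} {φ : EuclideanSpace ℝ (Fin N) → ℝ}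
    (hφ : IsAlphaConcaveOn (1 / m) Ω φ) (hopen : IsOpen Ω) (hbdd : Bornology.IsBounded Ω) :
    ∃ M, ∀ x ∈ Ω, φ x ≤ M := by
  rcases Ω.eq_empty_or_nonempty with rfl | ⟨c, hc⟩
  · exact ⟨0, by simp⟩
  obtain ⟨ε, hε, hball⟩ := Metric.isOpen_iff.1 hopen c hc
  set t : ℝ := ε / (Metric.diam Ω + 1) with ht
  have hD : 0 < Metric.diam Ω + 1 := by linarith [Metric.diam_nonneg (s := Ω)]
  have ht0 : 0 < t := by positivity
  refine ⟨(φ c ^ (1 / m : ℝ) * ((1 + t) / t)) ^ m, fun x hx => ?_⟩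
  have hz : c - t • (x - c) ∈ Ω := by
    apply hball
    rw [Metric.mem_ball, dist_eq_norm, sub_sub_cancel_left, norm_neg, norm_smul, Real.norm_eq_abs,
      abs_of_pos ht0, ← dist_eq_norm, ht, div_mul_eq_mul_div, div_lt_iff₀ hD]
    have := Metric.dist_le_diam_of_mem hbdd hx hc
    gcongr
    linarith
  have h := hφ.2.2 hz hx (by positivity : 0 ≤ 1 / (1 + t)) (by positivity : 0 ≤ t / (1 + t))
    (by field_simp)
  have hcomb : (1 / (1 + t)) • (c - t • (x - c)) + (t / (1 + t)) • x = c := by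
    match_scalars <;> field_simp <;> ring
  rw [hcomb] at h
  simp only [smul_eq_mul] at h
  have h1 := Real.rpow_nonneg (hφ.1 _ hz).le (1 / m : ℝ)
  have h2 := Real.rpow_nonneg (hφ.1 x hx).le (1 / m : ℝ)
  have h3 : t / (1 + t) * φ x ^ (1 / m : ℝ) ≤ φ c ^ (1 / m : ℝ) := by
    have : 0 ≤ 1 / (1 + t) * φ (c - t • (x - c)) ^ (1 / m : ℝ) := by positivity
    linarith
  calc φ x = (φ x ^ (1 / m : ℝ)) ^ m := (rpow_one_div_pow hm (hφ.1 x hx).le).symm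
    _ ≤ _ := by
        refine pow_le_pow_left₀ h2 ?_ m
        calc φ x ^ (1 / m : ℝ) = t / (1 + t) * φ x ^ (1 / m : ℝ) * ((1 + t) / t) := by field_simp
          _ ≤ _ := by gcongr

theorem IsAlphaConcaveOn.integrableOn {m : ℕ} (hm : 0 < m)
    {Ω : Set (EuclideanSpace ℝ (Fin N))} {φ : EuclideanSpace ℝ (Fin N) → ℝ}
    (hφ : IsAlphaConcaveOn (1 / m) Ω φ) (hopen : IsOpen Ω) (hbdd : Bornology.IsBounded Ω) :
    IntegrableOn φ Ω := by
  obtain ⟨M, hM⟩ := hφ.exists_le hm hopen hbdd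
  have hcont : ContinuousOn φ Ω := by
    refine ((hφ.2.continuousOn hopen).pow m).congr fun x hx =>
      (rpow_one_div_pow hm (hφ.1 x hx).le).symm
  refine IntegrableOn.of_bound hbdd.measure_lt_top
    (hcont.aestronglyMeasurable hopen.measurableSet) M ?_
  refine (ae_restrict_iff' hopen.measurableSet).2 (ae_of_all _ fun x hx => ?_)
  rw [Real.norm_eq_abs, abs_of_pos (hφ.1 x hx)]
  exact hM x hx

/-- Halving the radius of a ball centred in `Ω` decreases the weighted mass by at most
`2 ^ (N + m)`. -/
theorem IsAlphaConcaveOn.half_pow_mul_setIntegral_le {m : ℕ} (hm : 0 < m)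
    {Ω : Set (EuclideanSpace ℝ (Fin N))} {φ : EuclideanSpace ℝ (Fin N) → ℝ}
    (hφ : IsAlphaConcaveOn (1 / m) Ω φ) (hopen : IsOpen Ω) (hbdd : Bornology.IsBounded Ω)
    {c : EuclideanSpace ℝ (Fin N)} (hc : c ∈ Ω) (r : ℝ) :
    (1 / 2) ^ (N + m) * ∫ x in Ω ∩ Metric.closedBall c r, φ x ≤
      ∫ x in Ω ∩ Metric.closedBall c (r / 2), φ x := by
  set A := Ω ∩ Metric.closedBall c r
  set B := Ω ∩ Metric.closedBall c (r / 2)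
  have hint := hφ.integrableOn hm hopen hbdd
  have hAm : MeasurableSet A := hopen.measurableSet.inter Metric.isClosed_closedBall.measurableSet
  have hBm : MeasurableSet B := hopen.measurableSet.inter Metric.isClosed_closedBall.measurableSet
  set h : EuclideanSpace ℝ (Fin N) → EuclideanSpace ℝ (Fin N) :=
    fun x => (1 / 2 : ℝ) • c + (1 / 2 : ℝ) • x with hh
  have hder : ∀ x ∈ A, HasFDerivWithinAt h
      ((1 / 2 : ℝ) • ContinuousLinearMap.id ℝ (EuclideanSpace ℝ (Fin N))) A x := fun x _ =>
    (((hasFDerivAt_id x).const_smul (1 / 2 : ℝ)).const_add _).hasFDerivWithinAt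
  have hinj : Set.InjOn h A := fun x _ y _ hxy => by simpa [hh] using hxy
  have hdet : |((1 / 2 : ℝ) • ContinuousLinearMap.id ℝ (EuclideanSpace ℝ (Fin N))).det|
      = (1 / 2) ^ N := by
    simp [ContinuousLinearMap.det]
  have himage : h '' A ⊆ B := by
    rintro _ ⟨x, ⟨hxΩ, hxr⟩, rfl⟩
    refine ⟨hφ.2.1 hc hxΩ (by norm_num) (by norm_num) (by norm_num), ?_⟩
    have : h x - c = (1 / 2 : ℝ) • (x - c) := by
      simp only [hh]; module
    rw [Metric.mem_closedBall, dist_eq_norm] at hxr ⊢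
    rw [this, norm_smul, Real.norm_eq_abs, abs_of_pos (by norm_num)]
    linarith
  have hcv := integral_image_eq_integral_abs_det_fderiv_smul volume hAm hder hinj φ
  have hcvi := integrableOn_image_iff_integrableOn_abs_det_fderiv_smul volume hAm hder hinj φ
  have hiB : IntegrableOn φ B := hint.mono_set inter_subset_left
  calc (1 / 2) ^ (N + m) * ∫ x in A, φ x
      = ∫ x in A, (1 / 2) ^ N * ((1 / 2) ^ m * φ x) := by
        rw [← integral_const_mul]; congr 1; ext x; ring
    _ ≤ ∫ x in A, |((1 / 2 : ℝ) • ContinuousLinearMap.id ℝ (EuclideanSpace ℝ (Fin N))).det|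
          • φ (h x) := by
        refine setIntegral_mono_on (((hint.mono_set inter_subset_left).const_mul _).const_mul _)
          (hcvi.1 (hiB.mono_set himage)) hAm fun x hx => ?_
        rw [hdet, smul_eq_mul]
        gcongr
        exact hφ.half_pow_mul_le_midpoint hm hc hx.1
    _ = ∫ x in h '' A, φ x := hcv.symm
    _ ≤ ∫ x in B, φ x := setIntegral_mono_set hiB
        ((ae_restrict_iff' hBm).2 (ae_of_all _ fun x hx => (hφ.1 x hx.1).le))
        himage.eventuallyLE

theorem integrableOn_mul_coneFn_rpow {Ω : Set (EuclideanSpace ℝ (Fin N))}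
    {φ : EuclideanSpace ℝ (Fin N) → ℝ} (hint : IntegrableOn φ Ω)
    (c : EuclideanSpace ℝ (Fin N)) {r : ℝ} (hr : 0 ≤ r) {q : ℝ} (hq : 0 ≤ q) :
    IntegrableOn (fun x => φ x * coneFn c r x ^ q) Ω := by
  refine Integrable.mul_bdd (c := r ^ q) hint ?_ (ae_of_all _ fun x => ?_)
  · exact ((lipschitzWith_coneFn c r).continuous.rpow_const
      fun _ => Or.inr hq).aestronglyMeasurable
  · rw [Real.norm_eq_abs, abs_of_nonneg (Real.rpow_nonneg (coneFn_nonneg c r x) q)]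
    exact Real.rpow_le_rpow (coneFn_nonneg c r x) (coneFn_le c hr x) hq

theorem setIntegral_mul_coneFn_rpow_pos {Ω : Set (EuclideanSpace ℝ (Fin N))}
    {φ : EuclideanSpace ℝ (Fin N) → ℝ} (hopen : IsOpen Ω) (hint : IntegrableOn φ Ω)
    (hpos : ∀ x ∈ Ω, 0 < φ x) {c : EuclideanSpace ℝ (Fin N)} (hc : c ∈ Ω) {r : ℝ} (hr : 0 < r)
    {q : ℝ} (hq : 0 ≤ q) :
    0 < ∫ x in Ω, φ x * coneFn c r x ^ q := by
  rw [setIntegral_pos_iff_support_of_nonneg_ae _ (integrableOn_mul_coneFn_rpow hint c hr.le hq)]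
  · refine ((hopen.inter Metric.isOpen_ball).measure_pos volume
      ⟨c, hc, Metric.mem_ball_self hr⟩).trans_le (measure_mono (t := _ ∩ _) fun x hx => ?_)
    exact ⟨(mul_pos (hpos x hx.1) (Real.rpow_pos_of_pos (coneFn_pos hx.2) q)).ne', hx.1⟩
  · exact (ae_restrict_iff' hopen.measurableSet).2 (ae_of_all _ fun x hx =>
      mul_nonneg (hpos x hx).le (Real.rpow_nonneg (coneFn_nonneg c r x) q))

/-- The weighted mass of a ball is controlled by the weighted `p`-norm of the cone function. -/
theorem IsAlphaConcaveOn.setIntegral_closedBall_le {m : ℕ} (hm : 0 < m)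
    {Ω : Set (EuclideanSpace ℝ (Fin N))} {φ : EuclideanSpace ℝ (Fin N) → ℝ}
    (hφ : IsAlphaConcaveOn (1 / m) Ω φ) (hopen : IsOpen Ω) (hbdd : Bornology.IsBounded Ω)
    {c : EuclideanSpace ℝ (Fin N)} (hc : c ∈ Ω) {r : ℝ} (hr : 0 < r) {p : ℝ} (hp : 0 ≤ p) :
    ∫ x in Ω ∩ Metric.closedBall c r, φ x ≤
      2 ^ (N + m) * (2 / r) ^ p * ∫ x in Ω, φ x * coneFn c r x ^ p := by
  have hint := hφ.integrableOn hm hopen hbdd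
  have hhalf := hφ.half_pow_mul_setIntegral_le hm hopen hbdd hc r
  have hintc := integrableOn_mul_coneFn_rpow hint c hr.le hp
  have hBm : MeasurableSet (Ω ∩ Metric.closedBall c (r / 2)) :=
    hopen.measurableSet.inter Metric.isClosed_closedBall.measurableSet
  have hcone : (r / 2) ^ p * ∫ x in Ω ∩ Metric.closedBall c (r / 2), φ x ≤
      ∫ x in Ω, φ x * coneFn c r x ^ p := by
    calc (r / 2) ^ p * ∫ x in Ω ∩ Metric.closedBall c (r / 2), φ x
        = ∫ x in Ω ∩ Metric.closedBall c (r / 2), (r / 2) ^ p * φ x :=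
          (integral_const_mul _ _).symm
      _ ≤ ∫ x in Ω ∩ Metric.closedBall c (r / 2), φ x * coneFn c r x ^ p := by
          refine setIntegral_mono_on ((hint.mono_set inter_subset_left).const_mul _)
            (hintc.mono_set inter_subset_left) hBm fun x hx => ?_
          rw [mul_comm]
          have := (hφ.1 x hx.1).le
          gcongr
          exact le_max_of_le_left (by linarith [Metric.mem_closedBall.1 hx.2])
      _ ≤ _ := setIntegral_mono_set hintc
          ((ae_restrict_iff' hopen.measurableSet).2 (ae_of_all _ fun x hx =>
            mul_nonneg (hφ.1 x hx).le (Real.rpow_nonneg (coneFn_nonneg c r x) p)))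
          (inter_subset_left (s := Ω)).eventuallyLE
  have hr2 : (2 / r) ^ p * (r / 2) ^ p = 1 := by
    rw [← Real.mul_rpow (by positivity) (by positivity), div_mul_div_cancel₀ hr.ne',
      div_self two_ne_zero, Real.one_rpow]
  have h2 : (2 : ℝ) ^ (N + m) * (1 / 2) ^ (N + m) = 1 := by rw [← mul_pow]; norm_num
  calc ∫ x in Ω ∩ Metric.closedBall c r, φ x
      = 2 ^ (N + m) * ((1 / 2) ^ (N + m) * ∫ x in Ω ∩ Metric.closedBall c r, φ x) := by
        rw [← mul_assoc, h2, one_mul]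
    _ ≤ 2 ^ (N + m) * ∫ x in Ω ∩ Metric.closedBall c (r / 2), φ x := by gcongr
    _ = 2 ^ (N + m) * (2 / r) ^ p *
          ((r / 2) ^ p * ∫ x in Ω ∩ Metric.closedBall c (r / 2), φ x) := by
        rw [mul_assoc, ← mul_assoc ((2 / r) ^ p), hr2, one_mul]
    _ ≤ _ := by gcongr

theorem two_pow_mul_rpow_le_Kkroger {p : ℝ} (hp : 0 ≤ p) {k : ℕ} (hk : 2 ≤ k) :
    2 ^ k * (4 * √2) ^ p ≤ Kkroger p k := by
  have hk' : (2 : ℝ) ≤ k := by exact_mod_cast hk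
  have h4 : (4 * √2 : ℝ) = 2 ^ (5 / 2 : ℝ) := by
    rw [show (5 / 2 : ℝ) = 2 + 1 / 2 by norm_num, Real.rpow_add two_pos, Real.sqrt_eq_rpow]
    norm_num
  unfold Kkroger
  calc (2 : ℝ) ^ k * (4 * √2) ^ p
      = 2 ^ ((k : ℝ) + 5 / 2 * p) := by
        rw [h4, ← Real.rpow_mul two_pos.le, Real.rpow_add two_pos, Real.rpow_natCast]
    _ ≤ 2 ^ (((k : ℝ) + 3 * p) / 2 + (k + p)) :=
        Real.rpow_le_rpow_of_exponent_le one_le_two (by linarith)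
    _ = 1 * 2 ^ (((k : ℝ) + 3 * p) / 2) * 2 ^ ((k : ℝ) + p) := by
        rw [Real.rpow_add two_pos, one_mul]
    _ ≤ _ := by
        gcongr
        linarith

theorem norm_fderiv_const_mul_coneFn_le (a : ℝ) (c : EuclideanSpace ℝ (Fin N)) (r : ℝ)
    (x : EuclideanSpace ℝ (Fin N)) : ‖fderiv ℝ (fun y => a * coneFn c r y) x‖ ≤ |a| := by
  have h : LipschitzWith (‖a‖₊ * 1) (fun y => a * coneFn c r y) :=
    (lipschitzWith_smul a).comp (lipschitzWith_coneFn c r)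
  simpa using norm_fderiv_le_of_lipschitz ℝ h (x₀ := x)

theorem norm_fderiv_coneFn_sub_rpow_le {a b : ℝ} (ha : 0 ≤ a) (hb : 0 ≤ b)
    {c d : EuclideanSpace ℝ (Fin N)} {r : ℝ} (hcd : 2 * r < dist c d) {p : ℝ} (hp : 0 < p)
    (x : EuclideanSpace ℝ (Fin N)) :
    ‖fderiv ℝ (fun y => a * coneFn c r y - b * coneFn d r y) x‖ ^ p ≤
      (Metric.closedBall c r).indicator (fun _ => a ^ p) x +
        (Metric.closedBall d r).indicator (fun _ => b ^ p) x := by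
  have hnhds : ∀ e : EuclideanSpace ℝ (Fin N), x ∉ Metric.closedBall e r →
      ∀ᶠ y in 𝓝 x, coneFn e r y = 0 := fun e he => by
    filter_upwards [Metric.isClosed_closedBall.isOpen_compl.mem_nhds he] with y hy
    exact coneFn_eq_zero hy
  by_cases hd : x ∈ Metric.closedBall d r
  · have hc : x ∉ Metric.closedBall c r := fun hc => by
      rw [Metric.mem_closedBall] at hc hd
      linarith [dist_triangle_left c d x]
    have heq : (fun y => a * coneFn c r y - b * coneFn d r y) =ᶠ[𝓝 x]
        fun y => -b * coneFn d r y := by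
      filter_upwards [hnhds c hc] with y hy
      rw [hy]; ring
    rw [indicator_of_notMem hc, indicator_of_mem hd, zero_add, heq.fderiv_eq]
    have := norm_fderiv_const_mul_coneFn_le (-b) d r x
    rw [abs_neg, abs_of_nonneg hb] at this
    exact Real.rpow_le_rpow (norm_nonneg _) this hp.le
  · have heq : (fun y => a * coneFn c r y - b * coneFn d r y) =ᶠ[𝓝 x]
        fun y => a * coneFn c r y := by
      filter_upwards [hnhds d hd] with y hy
      rw [hy]; ring
    rw [indicator_of_notMem hd, add_zero, heq.fderiv_eq]
    by_cases hc : x ∈ Metric.closedBall c r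
    · rw [indicator_of_mem hc]
      have := norm_fderiv_const_mul_coneFn_le a c r x
      rw [abs_of_nonneg ha] at this
      exact Real.rpow_le_rpow (norm_nonneg _) this hp.le
    · have hzero : (fun y => a * coneFn c r y) =ᶠ[𝓝 x] fun _ => 0 := by
        filter_upwards [hnhds c hc] with y hy
        rw [hy, mul_zero]
      rw [indicator_of_notMem hc, hzero.fderiv_eq, fderiv_const_apply, norm_zero,
        Real.zero_rpow hp.ne']

theorem coneFn_eq_zero_or_eq_zero {c d : EuclideanSpace ℝ (Fin N)} {r : ℝ}
    (hcd : 2 * r < dist c d) (x : EuclideanSpace ℝ (Fin N)) :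
    coneFn c r x = 0 ∨ coneFn d r x = 0 := by
  by_cases hc : x ∈ Metric.closedBall c r
  · refine Or.inr (coneFn_eq_zero fun hd => ?_)
    rw [Metric.mem_closedBall] at hc hd
    linarith [dist_triangle_left c d x]
  · exact Or.inl (coneFn_eq_zero hc)

theorem abs_rpow_sub_two_mul_self {t p : ℝ} (ht : 0 ≤ t) (hp : 1 < p) :
    |t| ^ (p - 2) * t = t ^ (p - 1) := by
  rcases ht.eq_or_lt with rfl | ht
  · rw [mul_zero, Real.zero_rpow (by linarith)]
  · rw [abs_of_pos ht, ← Real.rpow_add_one ht.ne']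
    congr 1
    ring

theorem abs_coneFn_sub_rpow {a b : ℝ} (ha : 0 ≤ a) (hb : 0 ≤ b)
    {c d : EuclideanSpace ℝ (Fin N)} {r : ℝ} (hcd : 2 * r < dist c d) {p : ℝ} (hp : 0 < p)
    (x : EuclideanSpace ℝ (Fin N)) :
    |a * coneFn c r x - b * coneFn d r x| ^ p =
      a ^ p * coneFn c r x ^ p + b ^ p * coneFn d r x ^ p := by
  have hc := coneFn_nonneg c r x
  have hd := coneFn_nonneg d r x
  rcases coneFn_eq_zero_or_eq_zero hcd x with h | h
  · rw [h, mul_zero, zero_sub, abs_neg, abs_of_nonneg (mul_nonneg hb hd), Real.mul_rpow hb hd,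
      Real.zero_rpow hp.ne', mul_zero, zero_add]
  · rw [h, mul_zero, sub_zero, abs_of_nonneg (mul_nonneg ha hc), Real.mul_rpow ha hc,
      Real.zero_rpow hp.ne', mul_zero, add_zero]

theorem abs_coneFn_sub_rpow_mul_self {a b : ℝ} (ha : 0 ≤ a) (hb : 0 ≤ b)
    {c d : EuclideanSpace ℝ (Fin N)} {r : ℝ} (hcd : 2 * r < dist c d) {p : ℝ} (hp : 1 < p)
    (x : EuclideanSpace ℝ (Fin N)) :
    |a * coneFn c r x - b * coneFn d r x| ^ (p - 2) * (a * coneFn c r x - b * coneFn d r x) =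
      a ^ (p - 1) * coneFn c r x ^ (p - 1) - b ^ (p - 1) * coneFn d r x ^ (p - 1) := by
  have hc := coneFn_nonneg c r x
  have hd := coneFn_nonneg d r x
  have hp1 : p - 1 ≠ 0 := by linarith
  rcases coneFn_eq_zero_or_eq_zero hcd x with h | h
  · rw [h, mul_zero, zero_sub, abs_neg, mul_neg, abs_rpow_sub_two_mul_self (mul_nonneg hb hd) hp,
      Real.mul_rpow hb hd, Real.zero_rpow hp1, mul_zero, zero_sub]
  · rw [h, mul_zero, sub_zero, abs_rpow_sub_two_mul_self (mul_nonneg ha hc) hp,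
      Real.mul_rpow ha hc, Real.zero_rpow hp1, mul_zero, sub_zero]

/-- The admissible Rayleigh quotients are nonnegative, so each of them bounds `muP` above. -/
theorem muP_le {p : ℝ} {Ω : Set (EuclideanSpace ℝ (Fin N))} {φ : EuclideanSpace ℝ (Fin N) → ℝ}
    (hΩ : MeasurableSet Ω) (hφ : ∀ x ∈ Ω, 0 ≤ φ x)
    {u : EuclideanSpace ℝ (Fin N) → ℝ} {K : NNReal} (hu : LipschitzWith K u)
    (hu0 : ¬ ∀ᵐ x ∂(volume.restrict Ω), u x = 0)
    (hmean : (∫ x in Ω, φ x * |u x| ^ (p - 2) * u x) = 0) :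
    muP p Ω φ ≤ (∫ x in Ω, φ x * ‖fderiv ℝ u x‖ ^ p) / (∫ x in Ω, φ x * |u x| ^ p) := by
  refine csInf_le ⟨0, ?_⟩ ⟨u, K, hu, hu0, hmean, rfl⟩
  rintro _ ⟨v, -, -, -, -, rfl⟩
  exact div_nonneg
    (setIntegral_nonneg hΩ fun x hx =>
      mul_nonneg (hφ x hx) (Real.rpow_nonneg (norm_nonneg _) p))
    (setIntegral_nonneg hΩ fun x hx => mul_nonneg (hφ x hx) (Real.rpow_nonneg (abs_nonneg _) p))

/-- Two cones at points of `Ω` with disjoint supports give an upper bound for `muP`. -/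
theorem IsAlphaConcaveOn.muP_le_of_two_mul_lt_dist {p : ℝ} (hp : 1 < p) {m : ℕ} (hm : 0 < m)
    {Ω : Set (EuclideanSpace ℝ (Fin N))} {φ : EuclideanSpace ℝ (Fin N) → ℝ}
    (hφ : IsAlphaConcaveOn (1 / m) Ω φ) (hopen : IsOpen Ω) (hbdd : Bornology.IsBounded Ω)
    {c d : EuclideanSpace ℝ (Fin N)} (hc : c ∈ Ω) (hd : d ∈ Ω) {r : ℝ} (hr : 0 < r)
    (hcd : 2 * r < dist c d) :
    muP p Ω φ ≤ 2 ^ (N + m) * (2 / r) ^ p := by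
  have hp0 : 0 < p := by linarith
  have hp1 : 0 < p - 1 := by linarith
  have hint := hφ.integrableOn hm hopen hbdd
  have hΩ := hopen.measurableSet
  have hSc := setIntegral_mul_coneFn_rpow_pos hopen hint hφ.1 hc hr hp1.le
  have hSd := setIntegral_mul_coneFn_rpow_pos hopen hint hφ.1 hd hr hp1.le
  set Sc := ∫ x in Ω, φ x * coneFn c r x ^ (p - 1)
  set Sd := ∫ x in Ω, φ x * coneFn d r x ^ (p - 1)
  have hJc := setIntegral_mul_coneFn_rpow_pos hopen hint hφ.1 hc hr hp0.le
  have hJd := setIntegral_mul_coneFn_rpow_pos hopen hint hφ.1 hd hr hp0.le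
  have hIc := hφ.setIntegral_closedBall_le hm hopen hbdd hc hr hp0.le
  have hId := hφ.setIntegral_closedBall_le hm hopen hbdd hd hr hp0.le
  set Jc := ∫ x in Ω, φ x * coneFn c r x ^ p
  set Jd := ∫ x in Ω, φ x * coneFn d r x ^ p
  obtain ⟨a, ha, haS⟩ : ∃ a : ℝ, 0 < a ∧ a ^ (p - 1) = Sd :=
    ⟨Sd ^ (p - 1)⁻¹, Real.rpow_pos_of_pos hSd _, Real.rpow_inv_rpow hSd.le hp1.ne'⟩
  obtain ⟨b, hb, hbS⟩ : ∃ b : ℝ, 0 < b ∧ b ^ (p - 1) = Sc :=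
    ⟨Sc ^ (p - 1)⁻¹, Real.rpow_pos_of_pos hSc _, Real.rpow_inv_rpow hSc.le hp1.ne'⟩
  set u : EuclideanSpace ℝ (Fin N) → ℝ := fun x => a * coneFn c r x - b * coneFn d r x
  have hlip : LipschitzWith (‖a‖₊ * 1 + ‖b‖₊ * 1) u :=
    ((lipschitzWith_smul a).comp (lipschitzWith_coneFn c r)).sub
      ((lipschitzWith_smul b).comp (lipschitzWith_coneFn d r))
  have hmean : ∫ x in Ω, φ x * |u x| ^ (p - 2) * u x = 0 := by
    calc ∫ x in Ω, φ x * |u x| ^ (p - 2) * u x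
        = ∫ x in Ω, (a ^ (p - 1) * (φ x * coneFn c r x ^ (p - 1)) -
            b ^ (p - 1) * (φ x * coneFn d r x ^ (p - 1))) := by
          congr 1; ext x
          rw [mul_assoc, abs_coneFn_sub_rpow_mul_self ha.le hb.le hcd hp]
          ring
      _ = Sd * Sc - Sc * Sd := by
          rw [integral_sub ((integrableOn_mul_coneFn_rpow hint c hr.le hp1.le).const_mul _)
            ((integrableOn_mul_coneFn_rpow hint d hr.le hp1.le).const_mul _),
            integral_const_mul, integral_const_mul, haS, hbS]
      _ = 0 := by ring
  have hden : ∫ x in Ω, φ x * |u x| ^ p = a ^ p * Jc + b ^ p * Jd := by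
    calc ∫ x in Ω, φ x * |u x| ^ p
        = ∫ x in Ω, (a ^ p * (φ x * coneFn c r x ^ p) + b ^ p * (φ x * coneFn d r x ^ p)) := by
          congr 1; ext x
          rw [abs_coneFn_sub_rpow ha.le hb.le hcd hp0]
          ring
      _ = _ := by
          rw [integral_add ((integrableOn_mul_coneFn_rpow hint c hr.le hp0.le).const_mul _)
            ((integrableOn_mul_coneFn_rpow hint d hr.le hp0.le).const_mul _),
            integral_const_mul, integral_const_mul]
  have hap := Real.rpow_pos_of_pos ha p
  have hbp := Real.rpow_pos_of_pos hb p
  have hdenpos : 0 < ∫ x in Ω, φ x * |u x| ^ p := by rw [hden]; positivity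
  have hu0 : ¬ ∀ᵐ x ∂(volume.restrict Ω), u x = 0 := fun h => by
    refine hdenpos.ne' (integral_eq_zero_of_ae ?_)
    filter_upwards [h] with x hx
    simp [hx, Real.zero_rpow hp0.ne']
  have hball : ∀ (e : EuclideanSpace ℝ (Fin N)) (s : ℝ),
      (fun x => φ x * (Metric.closedBall e r).indicator (fun _ => s) x) =
        (Metric.closedBall e r).indicator (fun x => s * φ x) := fun e s => by
    ext x
    by_cases hx : x ∈ Metric.closedBall e r <;> simp [hx, mul_comm]
  have hballint : ∀ (e : EuclideanSpace ℝ (Fin N)) (s : ℝ),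
      IntegrableOn (fun x => φ x * (Metric.closedBall e r).indicator (fun _ => s) x) Ω :=
    fun e s => by
      rw [hball]
      exact (hint.const_mul s).indicator Metric.isClosed_closedBall.measurableSet
  have hballval : ∀ (e : EuclideanSpace ℝ (Fin N)) (s : ℝ),
      ∫ x in Ω, φ x * (Metric.closedBall e r).indicator (fun _ => s) x =
        s * ∫ x in Ω ∩ Metric.closedBall e r, φ x := fun e s => by
    rw [hball, setIntegral_indicator Metric.isClosed_closedBall.measurableSet, integral_const_mul]
  refine (muP_le hΩ (fun x hx => (hφ.1 x hx).le) hlip hu0 hmean).trans ?_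
  rw [div_le_iff₀ hdenpos, hden]
  calc ∫ x in Ω, φ x * ‖fderiv ℝ u x‖ ^ p
      ≤ ∫ x in Ω, (φ x * (Metric.closedBall c r).indicator (fun _ => a ^ p) x +
          φ x * (Metric.closedBall d r).indicator (fun _ => b ^ p) x) := by
        refine integral_mono_of_nonneg ?_ ((hballint c _).add (hballint d _)) ?_
        · exact (ae_restrict_iff' hΩ).2 (ae_of_all _ fun x hx =>
            mul_nonneg (hφ.1 x hx).le (Real.rpow_nonneg (norm_nonneg _) p))
        · refine (ae_restrict_iff' hΩ).2 (ae_of_all _ fun x hx => ?_)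
          have := mul_le_mul_of_nonneg_left
            (norm_fderiv_coneFn_sub_rpow_le ha.le hb.le hcd hp0 x) (hφ.1 x hx).le
          rwa [mul_add] at this
    _ = a ^ p * (∫ x in Ω ∩ Metric.closedBall c r, φ x) +
          b ^ p * ∫ x in Ω ∩ Metric.closedBall d r, φ x := by
        rw [integral_add (hballint c _) (hballint d _), hballval, hballval]
    _ ≤ a ^ p * (2 ^ (N + m) * (2 / r) ^ p * Jc) + b ^ p * (2 ^ (N + m) * (2 / r) ^ p * Jd) := by
        gcongr
    _ = _ := by ring

theorem exists_lt_dist_of_lt_diam {Ω : Set (EuclideanSpace ℝ (Fin N))} {s : ℝ} (hs : 0 ≤ s)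
    (h : s < Metric.diam Ω) : ∃ c ∈ Ω, ∃ d ∈ Ω, s < dist c d := by
  by_contra! hcon
  exact h.not_ge (Metric.diam_le_of_forall_dist_le hs hcon)

theorem diam_pos_of_isOpen (hN : 1 ≤ N) {Ω : Set (EuclideanSpace ℝ (Fin N))} (hopen : IsOpen Ω)
    (hbdd : Bornology.IsBounded Ω) (hne : Ω.Nonempty) : 0 < Metric.diam Ω := by
  have : Nonempty (Fin N) := ⟨⟨0, hN⟩⟩
  refine Metric.diam_pos (not_subsingleton_iff.1 fun hsub => ?_) hbdd
  obtain ⟨x, rfl⟩ := hsub.eq_empty_or_singleton.resolve_left hne.ne_empty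
  exact not_isOpen_singleton x hopen

end ConeTest

/-- Lemma 4.7, Kröger-type upper bound: for `Ω ⊂ ℝ^N` open bounded
convex with diameter `D_Ω` and `φ` positive `(1/m)`-concave,
`μ_p(Ω,φ) ≤ K_kroger(p,N+m)/D_Ω^p`. -/
theorem stmt12 (p : ℝ) (hp : 1 < p) (m N : ℕ) (hm : 0 < m) (hN : 1 ≤ N)
    (Ω : Set (EuclideanSpace ℝ (Fin N)))
    (hopen : IsOpen Ω) (hconv : Convex ℝ Ω) (hbdd : Bornology.IsBounded Ω) (hne : Ω.Nonempty)
    (φ : EuclideanSpace ℝ (Fin N) → ℝ)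
    (hφ : IsAlphaConcaveOn (1 / m) Ω φ) :
    muP p Ω φ ≤ Kkroger p (N + m) / Metric.diam Ω ^ p := by
  have hD := diam_pos_of_isOpen hN hopen hbdd hne
  set D := Metric.diam Ω
  have h2 : 0 < √2 := by positivity
  have hr : 0 < D / (2 * √2) := by positivity
  have hlt : 2 * (D / (2 * √2)) < D := by
    have : 1 < √2 := by rw [Real.lt_sqrt] <;> norm_num
    rw [← mul_div_assoc, mul_div_mul_left _ _ two_ne_zero]
    exact div_lt_self hD this
  obtain ⟨c, hc, d, hd, hcd⟩ := exists_lt_dist_of_lt_diam (by positivity) hlt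
  refine (hφ.muP_le_of_two_mul_lt_dist hp hm hopen hbdd hc hd hr hcd).trans ?_
  rw [show 2 / (D / (2 * √2)) = 4 * √2 / D by field_simp; norm_num,
    Real.div_rpow (by positivity) hD.le, ← mul_div_assoc]
  have := two_pow_mul_rpow_le_Kkroger (p := p) (by linarith) (k := N + m) (by omega)
  gcongr
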